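/- For every integer n ≥ 0, the unsigned Stirling number of the first kind satisfies [n+1, 4]/n! = (1/3)·H_n^{(3)} − (1/2)·H_n^{(2)}·H_n + (1/6)·H_n³ in ℚ, where H_n^{(i)} = Σ_{k=1}^{n} 1/k^i and H_n = H_n^{(1)}. -/

import Mathlib

/-- Unsigned Stirling numbers of the first kind (Stirling cycle numbers), via the
recurrence `[n+1, k+1] = n·[n, k+1] + [n, k]`. -/
def stirling1 : ℕ → ℕ → ℕ
  | 0, 0 => 1
  | 0, _ + 1 => 0
  | _ + 1, 0 => 0
  | n + 1, k + 1 => n * stirling1 n (k + 1) + stirling1 n k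

/-- Higher order harmonic numbers `H_n^{(i)} = Σ_{k=1}^n 1/k^i`. -/
def harmonicPow (n i : ℕ) : ℚ := ∑ k ∈ Finset.range n, 1 / ((k + 1 : ℚ)) ^ i

theorem stirling1_succ_one (n : ℕ) : stirling1 (n + 1) 1 = n.factorial := by
  induction n with
  | zero => simp [stirling1]
  | succ n ih => rw [stirling1.eq_4 (n + 1) 0, ih, stirling1, Nat.factorial_succ, add_zero]

theorem stirling1_succ_succ_div_factorial (n k : ℕ) :
    (stirling1 (n + 2) (k + 2) : ℚ) / ((n + 1).factorial : ℚ) =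
      (stirling1 (n + 1) (k + 2) : ℚ) / (n.factorial : ℚ) +
        (stirling1 (n + 1) (k + 1) : ℚ) / (n.factorial : ℚ) * ((n : ℚ) + 1)⁻¹ := by
  have hn : (n : ℚ) + 1 ≠ 0 := by positivity
  have hf : (n.factorial : ℚ) ≠ 0 := by positivity
  rw [stirling1.eq_4 (n + 1) (k + 1), Nat.factorial_succ]
  push_cast
  field_simp

theorem harmonicPow_succ (n i : ℕ) :
    harmonicPow (n + 1) i = harmonicPow n i + ((n : ℚ) + 1)⁻¹ ^ i := by
  simp [harmonicPow, Finset.sum_range_succ]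

theorem stirling1_two_div_factorial (n : ℕ) :
    (stirling1 (n + 1) 2 : ℚ) / (n.factorial : ℚ) = harmonic n := by
  induction n with
  | zero => simp [stirling1]
  | succ n ih =>
    have hf : (n.factorial : ℚ) ≠ 0 := by positivity
    rw [stirling1_succ_succ_div_factorial n 0, ih, stirling1_succ_one, div_self hf,
      harmonic_succ]
    push_cast
    ring

theorem stirling1_three_div_factorial (n : ℕ) :
    (stirling1 (n + 1) 3 : ℚ) / (n.factorial : ℚ) =
      (1 / 2) * ((harmonic n) ^ 2 - harmonicPow n 2) := by
  induction n with
  | zero => simp [stirling1, harmonicPow]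
  | succ n ih =>
    rw [stirling1_succ_succ_div_factorial n 1, ih, stirling1_two_div_factorial,
      harmonic_succ, harmonicPow_succ]
    push_cast
    ring

/-- `[n+1, 4]/n! = (1/3)·H_n^{(3)} - (1/2)·H_n^{(2)}·H_n + (1/6)·H_n³`. -/
theorem stirling1_four (n : ℕ) :
    (stirling1 (n + 1) 4 : ℚ) / (n.factorial : ℚ) =
      (1 / 3) * harmonicPow n 3 - (1 / 2) * harmonicPow n 2 * harmonic n +
        (1 / 6) * (harmonic n) ^ 3 := by
  induction n with
  | zero => simp [stirling1, harmonicPow]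
  | succ n ih =>
    rw [stirling1_succ_succ_div_factorial n 2, ih, stirling1_three_div_factorial,
      harmonic_succ, harmonicPow_succ, harmonicPow_succ]
    push_cast
    ring
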